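/- Let n be a nonnegative integer and let a, c ∈ ℂ satisfy c + j ≠ 0 for 0 ≤ j ≤ n−1 and c−a+n+j ≠ 0 for 0 ≤ j ≤ ⌊n/2⌋. Then (c−a)_n/(c)_n = Σ_{k=0}^{⌊n/2⌋} C(n,2k) (−1)^k (c−a+3k) (c−a)_k (a)_k (1−a)_k / ((c−a+n)_{k+1} (c)_{2k}) + Σ_{0 ≤ 2k+1 ≤ n} C(n,2k+1) (−1)^k (c−a)_{k+1} (a)_k (1−a)_{k+1} / ((c−a+n)_{k+1} (c)_{2k+1}). (Third-type reciprocal relation dual to the Chu–Vandermonde–Gauß summation formula, second form.) -/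

import Mathlib

/-- Rising factorial (Pochhammer symbol) of a complex number:
`poch x 0 = 1` and `poch x (m+1) = poch x m * (x + m)`. -/
noncomputable def poch (x : ℂ) : ℕ → ℂ
  | 0 => 1
  | m + 1 => poch x m * (x + (m : ℂ))

open Filter Topology

theorem poch_zero (x : ℂ) : poch x 0 = 1 := rfl

theorem poch_succ (x : ℂ) (m : ℕ) : poch x (m + 1) = poch x m * (x + (m : ℂ)) := rfl

theorem poch_succ_left (x : ℂ) (m : ℕ) : poch x (m + 1) = x * poch (x + 1) m := by
  induction m with
  | zero => simp [poch]
  | succ m ih =>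
    rw [poch_succ, ih, poch_succ]
    push_cast
    ring

theorem poch_ne_zero (x : ℂ) (m : ℕ) (h : ∀ j : ℕ, j < m → x + (j : ℂ) ≠ 0) :
    poch x m ≠ 0 := by
  induction m with
  | zero => simp [poch]
  | succ m ih =>
    rw [poch_succ]
    exact mul_ne_zero (ih fun j hj => h j (by omega)) (h m (by omega))

theorem continuous_poch (m : ℕ) : Continuous fun x : ℂ => poch x m := by
  induction m with
  | zero => simpa [poch] using continuous_const
  | succ m ih =>
    simp only [poch_succ]
    exact ih.mul (continuous_id.add continuous_const)

/-- The even-indexed term. -/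
noncomputable def evenTerm (a c : ℂ) (n k : ℕ) : ℂ :=
  (n.choose (2 * k) : ℂ) *
    ((-1 : ℂ) ^ k * (c - a + 3 * (k : ℂ)) * poch (c - a) k * poch a k * poch (1 - a) k) /
    (poch (c - a + (n : ℂ)) (k + 1) * poch c (2 * k))

/-- The odd-indexed term. -/
noncomputable def oddTerm (a c : ℂ) (n k : ℕ) : ℂ :=
  (n.choose (2 * k + 1) : ℂ) *
    ((-1 : ℂ) ^ k * poch (c - a) (k + 1) * poch a k * poch (1 - a) (k + 1)) /
    (poch (c - a + (n : ℂ)) (k + 1) * poch c (2 * k + 1))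

/-- The telescoping certificate. -/
noncomputable def cert (a c : ℂ) (n k : ℕ) : ℂ :=
  (n.choose (2 * k + 1) : ℂ) *
    ((-1 : ℂ) ^ k * poch (c - a) (k + 1) * poch a (k + 1) * poch (1 - a) (k + 1)) /
    (poch (c - a + (n : ℂ) + 1) (k + 1) * poch c (2 * k + 1))

/-- The difference that telescopes. -/
noncomputable def delta (a c : ℂ) (n k : ℕ) : ℂ :=
  (c + n) * (evenTerm a c (n + 1) k + oddTerm a c (n + 1) k)
    - (c - a + n) * (evenTerm a c n k + oddTerm a c n k)

theorem choose_rel (n m : ℕ) :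
    ((m : ℂ) + 1) * (n.choose (m + 1) : ℂ) = ((n : ℂ) - m) * (n.choose m : ℂ) := by
  rcases le_or_gt m n with h | h
  · have := Nat.choose_succ_right_eq n m
    have h2 : ((n.choose (m + 1) * (m + 1) : ℕ) : ℂ) = ((n.choose m * (n - m) : ℕ) : ℂ) := by
      rw [this]
    push_cast [Nat.cast_sub h] at h2
    linear_combination h2
  · rw [Nat.choose_eq_zero_of_lt h, Nat.choose_eq_zero_of_lt (by omega : n < m + 1)]
    simp

theorem delta_zero (a c : ℂ) (n : ℕ) (hc : ∀ j : ℕ, c + (j : ℂ) ≠ 0)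
    (hb : ∀ j : ℕ, c - a + (j : ℂ) ≠ 0) : delta a c n 0 = cert a c n 0 := by
  have h1 := hc 0
  have h2 := hb n
  have h3 := hb (n + 1)
  push_cast at h1 h3
  rw [add_zero] at h1
  rw [← add_assoc] at h3
  simp only [delta, cert, evenTerm, oddTerm, poch_succ, poch_zero]
  simp [← add_assoc]
  field_simp
  ring

theorem delta_succ (a c : ℂ) (n k : ℕ) (hc : ∀ j : ℕ, c + (j : ℂ) ≠ 0)
    (hb : ∀ j : ℕ, c - a + (j : ℂ) ≠ 0) :
    delta a c n (k + 1) = cert a c n (k + 1) - cert a c n k := by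
  have h1 := hc (2 * k + 1)
  have h1b := hc (2 * k + 2)
  have h2 := hb n
  have h3 := hb (n + 1 + (k + 1))
  have hQ : poch (c - a + n + 1) (k + 1) ≠ 0 := poch_ne_zero _ _ fun j _ => by
    have := hb (n + 1 + j)
    push_cast at this
    rwa [← add_assoc, ← add_assoc] at this
  have hC : poch c (2 * k + 1) ≠ 0 := poch_ne_zero _ _ fun j _ => hc j
  push_cast at h1 h1b h3
  have hX := choose_rel n (2 * k + 1)
  have hZ := choose_rel n (2 * k + 2)
  have e1 : (n + 1).choose (2 * (k + 1)) = n.choose (2 * k + 1) + n.choose (2 * k + 2) :=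
    Nat.choose_succ_succ n (2 * k + 1)
  have e2 : (n + 1).choose (2 * (k + 1) + 1) = n.choose (2 * k + 2) + n.choose (2 * k + 3) :=
    Nat.choose_succ_succ n (2 * k + 2)
  have e3 : n.choose (2 * (k + 1)) = n.choose (2 * k + 2) := rfl
  have e4 : n.choose (2 * (k + 1) + 1) = n.choose (2 * k + 3) := rfl
  have p1 : poch c (2 * (k + 1)) = poch c (2 * k + 1) * (c + (2 * k + 1)) := by
    have := poch_succ c (2 * k + 1)
    push_cast at this
    exact this
  have p2 : poch c (2 * (k + 1) + 1) = poch c (2 * k + 1) * (c + (2 * k + 1)) * (c + (2 * k + 2)) := by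
    rw [poch_succ, p1]
    push_cast
    ring
  have p3 : poch (c - a + n) (k + 1 + 1) = (c - a + n) * poch (c - a + n + 1) (k + 1) :=
    poch_succ_left _ _
  have p4 : poch (c - a + n + 1) (k + 1 + 1)
      = poch (c - a + n + 1) (k + 1) * (c - a + (n + 1 + (k + 1))) := by
    rw [poch_succ]
    push_cast
    ring
  have p5 : c - a + ((n + 1 : ℕ) : ℂ) = c - a + n + 1 := by push_cast; ring
  simp only [delta, cert, evenTerm, oddTerm, e1, e2, e3, e4, p5, p3, p4, p1, p2]
  rw [poch_succ (c - a) (k + 1), poch_succ a (k + 1), poch_succ (1 - a) (k + 1)]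
  push_cast at hX hZ ⊢
  generalize poch (c - a + n + 1) (k + 1) = Q at *
  generalize poch c (2 * k + 1) = C at *
  generalize poch (c - a) (k + 1) = B
  generalize poch a (k + 1) = A
  generalize poch (1 - a) (k + 1) = A2
  rw [show 2 * k + 1 + 1 = 2 * k + 2 from rfl] at hX
  rw [show 2 * k + 2 + 1 = 2 * k + 3 from rfl] at hZ
  generalize (n.choose (2 * k + 1) : ℂ) = X at *
  generalize (n.choose (2 * k + 2) : ℂ) = Y at *
  generalize (n.choose (2 * k + 3) : ℂ) = Z at *
  rw [pow_succ]
  generalize ((-1 : ℂ) ^ k) = s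
  generalize (n : ℂ) = n at *
  generalize (k : ℂ) = k at *
  have key : (c + n) * ((X + Y) * (c - a + 3 * (k + 1)) * (c + (2 * k + 2))
        + (Y + Z) * (c - a + (k + 1)) * (1 - a + (k + 1)))
      - (c - a + (n + 1 + (k + 1))) * (Y * (c - a + 3 * (k + 1)) * (c + (2 * k + 2))
        + Z * (c - a + (k + 1)) * (1 - a + (k + 1)))
      = Z * (c - a + (k + 1)) * (a + (k + 1)) * (1 - a + (k + 1))
        + X * (c - a + (n + 1 + (k + 1))) * (c + (2 * k + 1)) * (c + (2 * k + 2)) := by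
    linear_combination (-(c + (2 * k + 2)) * (1 - a + (k + 1))) * hX
      - (c - a + (k + 1)) * (1 - a + (k + 1)) * hZ
  generalize hq : c - a + (n + 1 + (k + 1)) = q at *
  generalize hd : c + (2 * k + 1) = d at *
  generalize he : c + (2 * k + 2) = e at *
  generalize hg : c - a + n = g at *
  trans (s * -1 * B * A * A2 / (Q * C * q * d * e)) *
    ((c + n) * ((X + Y) * (c - a + 3 * (k + 1)) * e
        + (Y + Z) * (c - a + (k + 1)) * (1 - a + (k + 1)))
      - q * (Y * (c - a + 3 * (k + 1)) * e
        + Z * (c - a + (k + 1)) * (1 - a + (k + 1))))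
  · field_simp
    ring
  · rw [key]
    field_simp
    ring

theorem sum_delta (a c : ℂ) (n K : ℕ) (hc : ∀ j : ℕ, c + (j : ℂ) ≠ 0)
    (hb : ∀ j : ℕ, c - a + (j : ℂ) ≠ 0) :
    ∑ k ∈ Finset.range (K + 1), delta a c n k = cert a c n K := by
  induction K with
  | zero => simpa using delta_zero a c n hc hb
  | succ K ih =>
    rw [Finset.sum_range_succ, ih, delta_succ a c n K hc hb]
    ring

theorem generic_sum (a c : ℂ) (n K : ℕ) (hn : n ≤ K) (hc : ∀ j : ℕ, c + (j : ℂ) ≠ 0)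
    (hb : ∀ j : ℕ, c - a + (j : ℂ) ≠ 0) :
    ∑ k ∈ Finset.range (K + 1), (evenTerm a c n k + oddTerm a c n k)
      = poch (c - a) n / poch c n := by
  induction n with
  | zero =>
    rw [Finset.sum_range_succ', Finset.sum_eq_zero]
    · have := hb 0
      simp at this
      simp [evenTerm, oddTerm, poch, this]
    · intro k _
      have : Nat.choose 0 (2 * (k + 1)) = 0 := Nat.choose_eq_zero_of_lt (by omega)
      simp [evenTerm, oddTerm, this]
  | succ n ih =>
    have h := sum_delta a c n K hc hb
    have h0 : cert a c n K = 0 := by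
      have : n.choose (2 * K + 1) = 0 := Nat.choose_eq_zero_of_lt (by omega)
      simp [cert, this]
    rw [h0] at h
    simp only [delta] at h
    rw [Finset.sum_sub_distrib, ← Finset.mul_sum, ← Finset.mul_sum, ih (by omega)] at h
    have hC : poch c n ≠ 0 := poch_ne_zero _ _ fun j _ => hc j
    have h1 := hc n
    rw [poch_succ, poch_succ]
    apply mul_left_cancel₀ h1
    rw [sub_eq_zero.mp h]
    field_simp

theorem generic_case (a c : ℂ) (n : ℕ) (hc : ∀ j : ℕ, c + (j : ℂ) ≠ 0)
    (hb : ∀ j : ℕ, c - a + (j : ℂ) ≠ 0) :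
    poch (c - a) n / poch c n = ∑ k ∈ Finset.range (n / 2 + 1), evenTerm a c n k +
      ∑ k ∈ Finset.range ((n + 1) / 2), oddTerm a c n k := by
  rw [← generic_sum a c n n le_rfl hc hb, Finset.sum_add_distrib]
  congr 1
  · symm
    apply Finset.sum_subset
    · intro k hk
      simp only [Finset.mem_range] at *
      omega
    · intro k _ hk
      simp only [Finset.mem_range] at hk
      have : n.choose (2 * k) = 0 := Nat.choose_eq_zero_of_lt (by omega)
      simp [evenTerm, this]
  · symm
    apply Finset.sum_subset
    · intro k hk
      simp only [Finset.mem_range] at *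
      omega
    · intro k _ hk
      simp only [Finset.mem_range] at hk
      have : n.choose (2 * k + 1) = 0 := Nat.choose_eq_zero_of_lt (by omega)
      simp [oddTerm, this]

/-- Third-type reciprocal relation dual to the Chu–Vandermonde–Gauß summation formula,
second form. -/
theorem cvg_reciprocal_third_second (n : ℕ) (a c : ℂ)
    (hc : ∀ j : ℕ, j < n → c + (j : ℂ) ≠ 0)
    (hca : ∀ j : ℕ, j ≤ n / 2 → c - a + (n : ℂ) + (j : ℂ) ≠ 0) :
    poch (c - a) n / poch c n =
      (∑ k ∈ Finset.range (n / 2 + 1),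
        (n.choose (2 * k) : ℂ) *
          ((-1 : ℂ) ^ k * (c - a + 3 * (k : ℂ)) * poch (c - a) k * poch a k * poch (1 - a) k) /
          (poch (c - a + (n : ℂ)) (k + 1) * poch c (2 * k))) +
      ∑ k ∈ Finset.range ((n + 1) / 2),
        (n.choose (2 * k + 1) : ℂ) *
          ((-1 : ℂ) ^ k * poch (c - a) (k + 1) * poch a k * poch (1 - a) (k + 1)) /
          (poch (c - a + (n : ℂ)) (k + 1) * poch c (2 * k + 1)) := by
  have hcont : ∀ (m : ℕ) (u : ℂ), ContinuousAt (fun z : ℂ => poch (z - a + u) m) c := fun m u =>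
    ((continuous_poch m).comp
      ((continuous_id.sub continuous_const).add continuous_const)).continuousAt
  have hcont0 : ∀ m : ℕ, ContinuousAt (fun z : ℂ => poch (z - a) m) c := fun m =>
    ((continuous_poch m).comp (continuous_id.sub continuous_const)).continuousAt
  have hcont1 : ∀ m : ℕ, ContinuousAt (fun z : ℂ => poch z m) c := fun m =>
    (continuous_poch m).continuousAt
  have hL : ContinuousAt (fun z : ℂ => poch (z - a) n / poch z n) c :=
    (hcont0 n).div (hcont1 n) (poch_ne_zero _ _ hc)
  have hE : ∀ k ∈ Finset.range (n / 2 + 1), ContinuousAt (fun z : ℂ => evenTerm a z n k) c := by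
    intro k hk
    simp only [Finset.mem_range] at hk
    unfold evenTerm
    refine ContinuousAt.div ?_ ((hcont _ _).mul (hcont1 _)) (mul_ne_zero ?_ ?_)
    · have := hcont0 k
      fun_prop
    · exact poch_ne_zero _ _ fun j hj => hca j (by omega)
    · exact poch_ne_zero _ _ fun j hj => hc j (by omega)
  have hO : ∀ k ∈ Finset.range ((n + 1) / 2),
      ContinuousAt (fun z : ℂ => oddTerm a z n k) c := by
    intro k hk
    simp only [Finset.mem_range] at hk
    unfold oddTerm
    refine ContinuousAt.div ?_ ((hcont _ _).mul (hcont1 _)) (mul_ne_zero ?_ ?_)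
    · have := hcont0 (k + 1)
      fun_prop
    · exact poch_ne_zero _ _ fun j hj => hca j (by omega)
    · exact poch_ne_zero _ _ fun j hj => hc j (by omega)
  have hR : ContinuousAt (fun z : ℂ => ∑ k ∈ Finset.range (n / 2 + 1), evenTerm a z n k +
      ∑ k ∈ Finset.range ((n + 1) / 2), oddTerm a z n k) c :=
    ContinuousAt.add (tendsto_finsetSum _ hE) (tendsto_finsetSum _ hO)
  let s : Set ℂ := Set.range (fun j : ℕ => -(j : ℂ)) ∪ Set.range (fun j : ℕ => a - (j : ℂ))
  have hs : s.Countable := (Set.countable_range _).union (Set.countable_range _)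
  have hd : Dense sᶜ := hs.dense_compl ℝ
  have : (𝓝[sᶜ] c).NeBot := mem_closure_iff_nhdsWithin_neBot.mp (hd c)
  have hev : (fun z : ℂ => poch (z - a) n / poch z n) =ᶠ[𝓝[sᶜ] c]
      (fun z : ℂ => ∑ k ∈ Finset.range (n / 2 + 1), evenTerm a z n k +
      ∑ k ∈ Finset.range ((n + 1) / 2), oddTerm a z n k) := by
    filter_upwards [self_mem_nhdsWithin] with z hz
    apply generic_case
    · intro j hj
      exact hz (Or.inl ⟨j, by linear_combination -hj⟩)
    · intro j hj
      exact hz (Or.inr ⟨j, by linear_combination -hj⟩)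
  change _ = ∑ k ∈ Finset.range (n / 2 + 1), evenTerm a c n k +
      ∑ k ∈ Finset.range ((n + 1) / 2), oddTerm a c n k
  exact tendsto_nhds_unique (hL.tendsto.mono_left nhdsWithin_le_nhds)
    ((hR.tendsto.mono_left nhdsWithin_le_nhds).congr' hev.symm)
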